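/- Let w : ℕ → ℝ with w_n > 0 for all n, let n ≥ 0, set φ(k) = ∑_{j=0}^k 1/w_j, let p*_n(z) = ∑_{k=0}^n (1 − φ(k)/φ(n+1)) z^k, and let q(z) = p*_n(z)(1 − z) − 1, so q(z) = −(1/φ(n+1)) ∑_{k=0}^{n+1} z^k/w_k. Then every complex zero z of q satisfies min_{0 ≤ k ≤ n} w_{k+1}/w_k ≤ |z| ≤ max_{0 ≤ k ≤ n} w_{k+1}/w_k. -/

import Mathlib

open scoped BigOperators ComplexConjugate
open Filter

def MemHw (w : ℕ → ℝ) (f : ℕ → ℂ) : Prop :=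
  Summable fun n => w n * ‖f n‖ ^ 2

noncomputable def normSqHw (w : ℕ → ℝ) (f : ℕ → ℂ) : ℝ :=
  ∑' n, w n * ‖f n‖ ^ 2

noncomputable def normHw (w : ℕ → ℝ) (f : ℕ → ℂ) : ℝ :=
  Real.sqrt (normSqHw w f)

noncomputable def innerHw (w : ℕ → ℝ) (f g : ℕ → ℂ) : ℂ :=
  ∑' n, (w n : ℂ) * f n * conj (g n)

noncomputable def cProd (f g : ℕ → ℂ) : ℕ → ℂ :=
  fun n => ∑ k ∈ Finset.range (n + 1), f k * g (n - k)

def onePS : ℕ → ℂ := fun n => if n = 0 then 1 else 0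

def IsPolySeq (p : ℕ → ℂ) : Prop := ∃ N, ∀ n, N < n → p n = 0

def DegLE (p : ℕ → ℂ) (n : ℕ) : Prop := ∀ m, n < m → p m = 0

def CyclicHw (w : ℕ → ℝ) (f : ℕ → ℂ) : Prop :=
  ∀ ε : ℝ, 0 < ε → ∃ p : ℕ → ℂ, IsPolySeq p ∧ normHw w (cProd p f - onePS) < ε

noncomputable def taylorCoeff (F : ℂ → ℂ) (n : ℕ) : ℂ :=
  iteratedDeriv n F 0 / (n.factorial : ℂ)

noncomputable def phiW (w : ℕ → ℝ) (k : ℕ) : ℝ :=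
  ∑ j ∈ Finset.range (k + 1), 1 / w j

def oneSubZ : ℕ → ℂ := fun k => if k = 0 then 1 else if k = 1 then -1 else 0

def zPow (i : ℕ) (f : ℕ → ℂ) : ℕ → ℂ :=
  fun m => if i ≤ m then f (m - i) else 0

/-- The coefficients of the `n`-th optimal approximant to `1/(1-z)`. -/
noncomputable def pstarW (w : ℕ → ℝ) (n : ℕ) : ℕ → ℂ :=
  fun k => if k ≤ n then ((1 - phiW w k / phiW w (n + 1) : ℝ) : ℂ) else 0

theorem sub_mul_sum_range_mul_pow {R : Type*} [CommRing R] (a : ℕ → R) (r z : R) (n : ℕ) :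
    (z - r) * ∑ k ∈ Finset.range (n + 2), a k * z ^ k =
      a (n + 1) * z ^ (n + 2) +
        ∑ k ∈ Finset.range (n + 1), (a k - r * a (k + 1)) * z ^ (k + 1) - r * a 0 := by
  induction n with
  | zero => simp [Finset.sum_range_succ]; ring
  | succ n ih =>
    rw [Finset.sum_range_succ, mul_add, ih, Finset.sum_range_succ _ (n + 1)]
    ring

theorem sum_range_mul_norm_pow_pos {a : ℕ → ℝ} (ha : ∀ k, 0 < a k) (z : ℂ) (n : ℕ) :
    0 < ∑ k ∈ Finset.range (n + 1), a k * ‖z‖ ^ k := by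
  rw [Finset.sum_range_succ']
  have h := ha 0
  have : 0 ≤ ∑ k ∈ Finset.range n, a (k + 1) * ‖z‖ ^ (k + 1) :=
    Finset.sum_nonneg fun k _ => mul_nonneg (ha _).le (by positivity)
  simpa using add_pos_of_nonneg_of_pos this h

/-- The upper bound in the Eneström–Kakeya theorem. -/
theorem norm_le_of_sum_range_mul_pow_eq_zero {a : ℕ → ℝ} (ha : ∀ k, 0 < a k) {n : ℕ} {r : ℝ}
    (hr : ∀ k < n + 1, a k ≤ r * a (k + 1)) {z : ℂ}
    (hz : ∑ k ∈ Finset.range (n + 2), (a k : ℂ) * z ^ k = 0) : ‖z‖ ≤ r := by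
  have hr0 : 0 ≤ r :=
    (pos_of_mul_pos_left ((ha 0).trans_le (hr 0 n.succ_pos)) (ha _).le).le
  have hC := sub_mul_sum_range_mul_pow (fun k => (a k : ℂ)) (r : ℂ) z n
  have hR := sub_mul_sum_range_mul_pow a r ‖z‖ n
  rw [hz, mul_zero] at hC
  have heq : (a (n + 1) : ℂ) * z ^ (n + 2) =
      ∑ k ∈ Finset.range (n + 1), ((r * a (k + 1) - a k : ℝ) : ℂ) * z ^ (k + 1) +
        ((r * a 0 : ℝ) : ℂ) := by
    have hs : ∑ k ∈ Finset.range (n + 1), ((r * a (k + 1) - a k : ℝ) : ℂ) * z ^ (k + 1) =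
        -∑ k ∈ Finset.range (n + 1), ((a k : ℂ) - r * a (k + 1)) * z ^ (k + 1) := by
      rw [← Finset.sum_neg_distrib]
      exact Finset.sum_congr rfl fun k _ => by push_cast; ring
    rw [hs]
    push_cast
    linear_combination -hC
  have hle : a (n + 1) * ‖z‖ ^ (n + 2) ≤
      ∑ k ∈ Finset.range (n + 1), (r * a (k + 1) - a k) * ‖z‖ ^ (k + 1) + r * a 0 := by
    calc a (n + 1) * ‖z‖ ^ (n + 2) = ‖(a (n + 1) : ℂ) * z ^ (n + 2)‖ := by
          simp [abs_of_pos (ha _)]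
      _ ≤ _ := by
        rw [heq]
        refine (norm_add_le _ _).trans (add_le_add ((norm_sum_le _ _).trans
          (Finset.sum_le_sum fun k hk => ?_)) ?_)
        · rw [norm_mul, norm_pow, Complex.norm_of_nonneg
            (sub_nonneg.2 (hr k (Finset.mem_range.1 hk)))]
        · rw [Complex.norm_of_nonneg (mul_nonneg hr0 (ha 0).le)]
  have hs : ∑ k ∈ Finset.range (n + 1), (r * a (k + 1) - a k) * ‖z‖ ^ (k + 1) =
      -∑ k ∈ Finset.range (n + 1), (a k - r * a (k + 1)) * ‖z‖ ^ (k + 1) := by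
    rw [← Finset.sum_neg_distrib]
    exact Finset.sum_congr rfl fun k _ => by ring
  have hpos := sum_range_mul_norm_pow_pos ha z (n + 1)
  by_contra! hlt
  have := mul_pos (sub_pos.2 hlt) hpos
  linarith

/-- The lower bound in the Eneström–Kakeya theorem. -/
theorem le_norm_of_sum_range_mul_pow_eq_zero {a : ℕ → ℝ} (ha : ∀ k, 0 < a k) {n : ℕ} {r : ℝ}
    (hr : ∀ k < n + 1, r * a (k + 1) ≤ a k) {z : ℂ}
    (hz : ∑ k ∈ Finset.range (n + 2), (a k : ℂ) * z ^ k = 0) : r ≤ ‖z‖ := by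
  have hC := sub_mul_sum_range_mul_pow (fun k => (a k : ℂ)) (r : ℂ) z n
  have hR := sub_mul_sum_range_mul_pow a r ‖z‖ n
  rw [hz, mul_zero] at hC
  have heq : ((r * a 0 : ℝ) : ℂ) = (a (n + 1) : ℂ) * z ^ (n + 2) +
      ∑ k ∈ Finset.range (n + 1), ((a k - r * a (k + 1) : ℝ) : ℂ) * z ^ (k + 1) := by
    push_cast
    linear_combination hC
  have hle : r * a 0 ≤ a (n + 1) * ‖z‖ ^ (n + 2) +
      ∑ k ∈ Finset.range (n + 1), (a k - r * a (k + 1)) * ‖z‖ ^ (k + 1) := by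
    calc r * a 0 ≤ ‖((r * a 0 : ℝ) : ℂ)‖ := by
          rw [Complex.norm_real]; exact Real.le_norm_self _
      _ ≤ _ := by
        rw [heq]
        refine (norm_add_le _ _).trans (add_le_add ?_ ((norm_sum_le _ _).trans
          (Finset.sum_le_sum fun k hk => ?_)))
        · rw [norm_mul, norm_pow, Complex.norm_of_nonneg (ha _).le]
        · rw [norm_mul, norm_pow, Complex.norm_of_nonneg
            (sub_nonneg.2 (hr k (Finset.mem_range.1 hk)))]
  have hpos := sum_range_mul_norm_pow_pos ha z (n + 1)
  by_contra! hlt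
  have := mul_neg_of_neg_of_pos (sub_neg.2 hlt) hpos
  linarith

theorem phiW_succ (w : ℕ → ℝ) (k : ℕ) : phiW w (k + 1) = phiW w k + 1 / w (k + 1) :=
  Finset.sum_range_succ _ _

theorem phiW_pos {w : ℕ → ℝ} (hw : ∀ n, 0 < w n) (k : ℕ) : 0 < phiW w k :=
  Finset.sum_pos (fun j _ => one_div_pos.2 (hw j)) ⟨0, by simp⟩

theorem sum_range_one_sub_phiW_div_mul (w : ℕ → ℝ) (F z : ℂ) (m : ℕ) :
    (∑ k ∈ Finset.range (m + 1), (1 - (phiW w k : ℂ) / F) * z ^ k) * (1 - z) - 1 =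
      -(1 / F) * ∑ k ∈ Finset.range (m + 1), z ^ k / (w k : ℂ) -
        (1 - (phiW w m : ℂ) / F) * z ^ (m + 1) := by
  induction m with
  | zero => simp [phiW]; ring
  | succ m ih =>
    rw [Finset.sum_range_succ, Finset.sum_range_succ _ (m + 1), phiW_succ]
    push_cast
    linear_combination ih

theorem sum_range_pstarW_mul {w : ℕ → ℝ} (hw : ∀ n, 0 < w n) (n : ℕ) (z : ℂ) :
    (∑ k ∈ Finset.range (n + 1), pstarW w n k * z ^ k) * (1 - z) - 1 =
      -(1 / (phiW w (n + 1) : ℂ)) * ∑ k ∈ Finset.range (n + 2), z ^ k / (w k : ℂ) := by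
  have hF : (phiW w (n + 1) : ℂ) ≠ 0 := Complex.ofReal_ne_zero.2 (phiW_pos hw _).ne'
  have hs : ∑ k ∈ Finset.range (n + 1), pstarW w n k * z ^ k =
      ∑ k ∈ Finset.range (n + 1), (1 - (phiW w k : ℂ) / (phiW w (n + 1) : ℂ)) * z ^ k :=
    Finset.sum_congr rfl fun k hk => by
      simp [pstarW, Nat.lt_succ_iff.1 (Finset.mem_range.1 hk)]
  have hlast : 1 - (phiW w n : ℂ) / (phiW w (n + 1) : ℂ) =
      1 / (phiW w (n + 1) : ℂ) * (1 / (w (n + 1) : ℂ)) := by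
    have h : (1 / w (n + 1) : ℂ) = phiW w (n + 1) - phiW w n := by
      rw [phiW_succ]
      push_cast
      ring
    rw [h, mul_sub, one_div_mul_cancel hF]
    ring
  rw [hs, sum_range_one_sub_phiW_div_mul, hlast, Finset.sum_range_succ _ (n + 1)]
  ring

theorem zeros_of_error_function
    (w : ℕ → ℝ) (hw : ∀ n, 0 < w n) (n : ℕ) :
    (∀ z : ℂ,
      (∑ k ∈ Finset.range (n + 1), pstarW w n k * z ^ k) * (1 - z) - 1
        = -(1 / (phiW w (n + 1) : ℂ)) *
            ∑ k ∈ Finset.range (n + 2), z ^ k / (w k : ℂ)) ∧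
    ∀ z : ℂ,
      (∑ k ∈ Finset.range (n + 1), pstarW w n k * z ^ k) * (1 - z) - 1 = 0 →
      (⨅ k : Fin (n + 1), w ((k : ℕ) + 1) / w (k : ℕ)) ≤ ‖z‖ ∧
      ‖z‖ ≤ ⨆ k : Fin (n + 1), w ((k : ℕ) + 1) / w (k : ℕ) := by
  refine ⟨sum_range_pstarW_mul hw n, fun z hz => ?_⟩
  rw [sum_range_pstarW_mul hw, mul_eq_zero] at hz
  have hF : (phiW w (n + 1) : ℂ) ≠ 0 := Complex.ofReal_ne_zero.2 (phiW_pos hw _).ne'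
  have hz' : ∑ k ∈ Finset.range (n + 2), (((w k)⁻¹ : ℝ) : ℂ) * z ^ k = 0 := by
    rw [← hz.resolve_left (neg_ne_zero.2 (one_div_ne_zero hF))]
    exact Finset.sum_congr rfl fun k _ => by push_cast; ring
  have ha : ∀ k, 0 < (w k)⁻¹ := fun k => inv_pos.2 (hw k)
  have hratio : ∀ k, (w k)⁻¹ = w (k + 1) / w k * (w (k + 1))⁻¹ := fun k => by
    have := (hw (k + 1)).ne'
    field_simp
  refine ⟨le_norm_of_sum_range_mul_pow_eq_zero ha (fun k hk => ?_) hz',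
    norm_le_of_sum_range_mul_pow_eq_zero ha (fun k hk => ?_) hz'⟩
  · rw [hratio k]
    exact mul_le_mul_of_nonneg_right
      (ciInf_le (f := fun k : Fin (n + 1) => w ((k : ℕ) + 1) / w (k : ℕ))
        (Set.finite_range _).bddBelow ⟨k, hk⟩) (ha _).le
  · rw [hratio k]
    exact mul_le_mul_of_nonneg_right
      (le_ciSup (f := fun k : Fin (n + 1) => w ((k : ℕ) + 1) / w (k : ℕ))
        (Set.finite_range _).bddAbove ⟨k, hk⟩) (ha _).le
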